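/- The tail of the gap distribution is quadratic: there exist constants C₁, C₂ > 0 and t₀ > 0 such that for all t ≥ t₀, C₁·t⁻² ≤ m({(a,b) ∈ Ω : R(a,b) ≥ t}) ≤ C₂·t⁻². -/

import Mathlib

open Matrix MeasureTheory Filter Topology

noncomputable section

abbrev SL2 := Matrix.SpecialLinearGroup (Fin 2) ℝ

/-- The golden ratio φ = (1+√5)/2. -/
def phi : ℝ := (1 + Real.sqrt 5) / 2

/-- φ̄ = 1/φ. -/
def phib : ℝ := phi⁻¹

/-- S = [[0,−1],[1,0]]. -/
def Smat : SL2 := ⟨!![0, -1; 1, 0], by norm_num [Matrix.det_fin_two_of]⟩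

/-- P = [[1,φ],[0,1]]. -/
def Pmat : SL2 := ⟨!![1, phi; 0, 1], by norm_num [Matrix.det_fin_two_of]⟩

/-- The Veech group of the golden L: the subgroup generated by S and P. -/
def Γ : Subgroup SL2 := Subgroup.closure {Smat, Pmat}

/-- Linear action of a 2×2 matrix on ℝ². -/
def mact (g : Matrix (Fin 2) (Fin 2) ℝ) (v : ℝ × ℝ) : ℝ × ℝ :=
  (g 0 0 * v.1 + g 0 1 * v.2, g 1 0 * v.1 + g 1 1 * v.2)

/-- Λ = Γ·(1,0)ᵀ. -/
def Λ : Set (ℝ × ℝ) := {v | ∃ γ ∈ Γ, v = mact (γ : Matrix (Fin 2) (Fin 2) ℝ) (1, 0)}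

/-- g_{a,b} = [[a,b],[0,1/a]]. -/
def gab (a b : ℝ) : Matrix (Fin 2) (Fin 2) ℝ := !![a, b; 0, a⁻¹]

/-- h_s = [[1,0],[−s,1]]. -/
def hmat (s : ℝ) : Matrix (Fin 2) (Fin 2) ℝ := !![1, 0; -s, 1]

/-- Ω = {(a,b) : 0 < a ≤ 1, 1 − aφ < b ≤ 1}. -/
def Ω : Set (ℝ × ℝ) := {p | 0 < p.1 ∧ p.1 ≤ 1 ∧ 1 - p.1 * phi < p.2 ∧ p.2 ≤ 1}

/-- Ω₁ = {(a,b) ∈ Ω : φ̄ ≤ a ≤ 1, 1 − aφ < b ≤ φ̄ − a}. -/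
def Ω₁ : Set (ℝ × ℝ) :=
  {p | p ∈ Ω ∧ phib ≤ p.1 ∧ p.1 ≤ 1 ∧ 1 - p.1 * phi < p.2 ∧ p.2 ≤ phib - p.1}

/-- Ω_φ = {(a,b) ∈ Ω : φ̄² ≤ a ≤ 1, φ̄ − a < b ≤ φ̄ − aφ̄}. -/
def Ωphi : Set (ℝ × ℝ) :=
  {p | p ∈ Ω ∧ phib ^ 2 ≤ p.1 ∧ p.1 ≤ 1 ∧ phib - p.1 < p.2 ∧ p.2 ≤ phib - p.1 * phib}

/-- Ω_∞ = {(a,b) ∈ Ω : φ̄ − aφ̄ < b ≤ 1}. -/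
def Ωinf : Set (ℝ × ℝ) := {p | p ∈ Ω ∧ phib - p.1 * phib < p.2 ∧ p.2 ≤ 1}

-- The return time function R.
open Classical in
noncomputable def Rfun (p : ℝ × ℝ) : ℝ :=
  if p ∈ Ω₁ then 1 / (p.1 * (p.1 + p.2))
  else if p ∈ Ωphi then 1 / (p.1 * (p.1 * phib + p.2))
  else 1 / (p.1 * p.2)

/-- The probability measure m with dm = (2/φ) da db on Ω. -/
noncomputable def m : Measure (ℝ × ℝ) := ENNReal.ofReal (2 / phi) • volume.restrict Ω

-- The golden-L BCZ map T.
open Classical in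
noncomputable def Tmap (p : ℝ × ℝ) : ℝ × ℝ :=
  if p ∈ Ω₁ then
    ((p.1 + p.2) * phi,
      p.1 + p.2 * phi +
        (-(⌊(p.1 + p.2 * phi - 1) / (phi ^ 2 * (p.1 + p.2))⌋ : ℤ) : ℝ) * phi ^ 2 * (p.1 + p.2))
  else if p ∈ Ωphi then
    (p.1 + p.2 * phi,
      p.2 + (-(⌊(p.2 - 1) / (phi * (p.1 + p.2 * phi))⌋ : ℤ) : ℝ) * phi * (p.1 + p.2 * phi))
  else
    (p.2, -p.1 + (-(⌊(-p.1 - 1) / (phi * p.2)⌋ : ℤ) : ℝ) * phi * p.2)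

lemma phi_sq : phi ^ 2 = phi + 1 := by
  have h := Real.sq_sqrt (show (0 : ℝ) ≤ 5 by norm_num)
  unfold phi
  nlinarith

lemma phi_gt : 1.6 < phi := by
  have h : (2.2 : ℝ) < Real.sqrt 5 := Real.lt_sqrt_of_sq_lt (by norm_num)
  unfold phi
  linarith

lemma phi_lt : phi < 1.62 := by
  have h : Real.sqrt 5 < 2.24 := (Real.sqrt_lt' (by norm_num)).2 (by norm_num)
  unfold phi
  linarith

lemma phib_eq : phib = phi - 1 := by
  refine inv_eq_of_mul_eq_one_right ?_
  linear_combination phi_sq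

/-- On `Ω₁` the return time is bounded. -/
lemma Rfun_lt_of_mem_Ω₁ {p : ℝ × ℝ} (hp : p ∈ Ω₁) : Rfun p < 100 := by
  have h1 := phi_gt
  have h2 := phi_lt
  rw [Rfun, if_pos hp]
  obtain ⟨-, ha, ha1, hb, -⟩ := hp
  rw [phib_eq] at ha
  have hs : 0.3 < p.1 + p.2 := by nlinarith
  have hm : 0.1 < p.1 * (p.1 + p.2) := by nlinarith
  rw [div_lt_iff₀ (by linarith)]
  linarith

/-- On `Ωphi` the return time is bounded. -/
lemma Rfun_lt_of_mem_Ωphi {p : ℝ × ℝ} (hp₁ : p ∉ Ω₁) (hp : p ∈ Ωphi) : Rfun p < 100 := by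
  have h1 := phi_gt
  have h2 := phi_lt
  rw [Rfun, if_neg hp₁, if_pos hp]
  obtain ⟨-, ha, ha1, hb, -⟩ := hp
  rw [phib_eq] at *
  have ha' : 0.3 < p.1 := by nlinarith
  have hs : 0.1 < p.1 * (phi - 1) + p.2 := by nlinarith
  have hm : 0.03 < p.1 * (p.1 * (phi - 1) + p.2) := by nlinarith
  rw [div_lt_iff₀ (by linarith)]
  linarith

/-- Outside `Ω₁` and `Ωphi`, a point of `Ω` lies in `Ωinf`. -/
lemma mem_Ωinf {p : ℝ × ℝ} (hp : p ∈ Ω) (hp₁ : p ∉ Ω₁) (hp₂ : p ∉ Ωphi) : p ∈ Ωinf := by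
  have h1 := phi_gt
  have h2 := phi_lt
  have h3 := phi_sq
  obtain ⟨ha, ha1, hb, hb1⟩ := id hp
  refine ⟨hp, ?_, hb1⟩
  by_contra! hc
  rw [phib_eq] at hc
  by_cases h : p.2 ≤ phib - p.1
  · refine hp₁ ⟨hp, ?_, ha1, hb, h⟩
    rw [phib_eq] at *
    by_contra! h'
    nlinarith
  · refine hp₂ ⟨hp, ?_, ha1, not_le.1 h, by rwa [phib_eq]⟩
    rw [phib_eq] at *
    nlinarith

lemma tail_subset {t : ℝ} (ht : 100 ≤ t) :
    {p : ℝ × ℝ | p ∈ Ω ∧ t ≤ Rfun p} ⊆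
      Set.Icc 0 (2 / t) ×ˢ Set.Icc (1 - 4 / t) 1 ∪ Set.Icc (1 - 8 / t) 1 ×ˢ Set.Icc 0 (4 / t) := by
  rintro p ⟨hp, hR⟩
  have h1 := phi_gt
  have h2 := phi_lt
  have hp₁ : p ∉ Ω₁ := fun h ↦ by linarith [Rfun_lt_of_mem_Ω₁ h]
  have hp₂ : p ∉ Ωphi := fun h ↦ by linarith [Rfun_lt_of_mem_Ωphi hp₁ h]
  obtain ⟨-, hb', -⟩ := mem_Ωinf hp hp₁ hp₂
  rw [Rfun, if_neg hp₁, if_neg hp₂] at hR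
  obtain ⟨ha, ha1, hb, hb1⟩ := hp
  rw [phib_eq] at hb'
  have hb0 : 0 < p.2 := by nlinarith
  have ht0 : 0 < t := by linarith
  have hab : 0 < p.1 * p.2 := mul_pos ha hb0
  rw [le_div_iff₀ hab] at hR
  have hu : 0 < t⁻¹ := inv_pos.2 ht0
  have hR' : p.1 * p.2 ≤ t⁻¹ := by
    rw [← one_div, le_div_iff₀ ht0]
    linarith
  simp only [div_eq_mul_inv, Set.mem_union, Set.mem_prod, Set.mem_Icc]
  rcases le_or_gt p.1 (1 / 4) with h | h
  · have hbl : 1 / 2 < p.2 := by nlinarith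
    have hal : p.1 ≤ 2 * t⁻¹ := by nlinarith
    exact Or.inl ⟨⟨ha.le, hal⟩, by nlinarith, hb1⟩
  · have hbu : p.2 ≤ 4 * t⁻¹ := by nlinarith
    exact Or.inr ⟨⟨by nlinarith, ha1⟩, hb0.le, hbu⟩

lemma box_subset_tail {t : ℝ} (ht : 100 ≤ t) :
    Set.Icc (1 / (2 * t)) (1 / t) ×ˢ Set.Icc (1 - 1 / (2 * t)) 1 ⊆
      {p : ℝ × ℝ | p ∈ Ω ∧ t ≤ Rfun p} := by
  rintro p ⟨⟨ha, ha1⟩, hb, hb1⟩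
  have h1 := phi_gt
  have h2 := phi_lt
  have ht0 : 0 < t := by linarith
  have hsmall : 1 / t ≤ 1 / 100 := one_div_le_one_div_of_le (by norm_num) ht
  have hu : 0 < 1 / (2 * t) := by positivity
  have hhalf : 1 / (2 * t) = 1 / t / 2 := by field_simp
  have hp₁ : p ∉ Ω₁ := by
    rintro ⟨-, h, -⟩
    rw [phib_eq] at h
    linarith
  have hp₂ : p ∉ Ωphi := by
    rintro ⟨-, h, -⟩
    rw [phib_eq] at h
    nlinarith
  have ha0 : 0 < p.1 := by linarith
  have hb0 : 0 < p.2 := by linarith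
  refine ⟨⟨ha0, by linarith, by nlinarith, hb1⟩, ?_⟩
  rw [Rfun, if_neg hp₁, if_neg hp₂, le_div_iff₀ (mul_pos ha0 hb0)]
  have := (le_div_iff₀ ht0).1 ha1
  nlinarith

lemma volume_real_Icc_prod_Icc {a b c d : ℝ} (hab : a ≤ b) (hcd : c ≤ d) :
    volume.real (Set.Icc a b ×ˢ Set.Icc c d) = (b - a) * (d - c) := by
  rw [Measure.volume_eq_prod, measureReal_prod_prod, Real.volume_real_Icc_of_le hab,
    Real.volume_real_Icc_of_le hcd]

lemma m_toReal_of_subset {s : Set (ℝ × ℝ)} (hs : s ⊆ Ω) :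
    (m s).toReal = 2 / phi * volume.real s := by
  have h1 := phi_gt
  have h2 : 0 ≤ 2 / phi := div_nonneg zero_le_two (by linarith)
  rw [m, Measure.smul_apply, Measure.restrict_eq_self _ hs, smul_eq_mul, ENNReal.toReal_mul,
    ENNReal.toReal_ofReal h2, Measure.real]

/-- The tail of the gap distribution is quadratic: C₁·t⁻² ≤ m({R ≥ t}) ≤ C₂·t⁻² for
all large t. -/
theorem quadratic_tail :
    ∃ C₁ C₂ t₀ : ℝ, 0 < C₁ ∧ 0 < C₂ ∧ 0 < t₀ ∧
      ∀ t : ℝ, t₀ ≤ t →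
        C₁ / t ^ 2 ≤ (m {p : ℝ × ℝ | p ∈ Ω ∧ t ≤ Rfun p}).toReal ∧
        (m {p : ℝ × ℝ | p ∈ Ω ∧ t ≤ Rfun p}).toReal ≤ C₂ / t ^ 2 := by
  refine ⟨1 / 4, 80, 100, by norm_num, by norm_num, by norm_num, fun t ht ↦ ?_⟩
  have h1 := phi_gt
  have h2 := phi_lt
  have ht0 : 0 < t := by linarith
  rw [m_toReal_of_subset (fun p hp ↦ hp.1)]
  have hc1 : 1 ≤ 2 / phi := by
    rw [le_div_iff₀ (by linarith)]
    linarith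
  have hc2 : 2 / phi ≤ 2 := by
    rw [div_le_iff₀ (by linarith)]
    linarith
  have hcompact : IsCompact (Set.Icc 0 (2 / t) ×ˢ Set.Icc (1 - 4 / t) 1 ∪
      Set.Icc (1 - 8 / t) 1 ×ˢ Set.Icc 0 (4 / t) : Set (ℝ × ℝ)) :=
    (isCompact_Icc.prod isCompact_Icc).union (isCompact_Icc.prod isCompact_Icc)
  have hfin := hcompact.measure_lt_top (μ := volume).ne
  have hupper := (measureReal_mono (tail_subset ht) hfin).trans (measureReal_union_le _ _)
  have hlower := measureReal_mono (box_subset_tail ht)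
    (measure_ne_top_of_subset (tail_subset ht) hfin)
  have hd : 0 < 1 / t := by positivity
  have e1 : 1 / (2 * t) ≤ 1 / t := one_div_le_one_div_of_le ht0 (by linarith)
  have e2 : 1 - 1 / (2 * t) ≤ 1 := by linarith [show 0 < 1 / (2 * t) by positivity]
  have e3 : 1 - 4 / t ≤ 1 := by linarith [show 0 < 4 / t by positivity]
  have e4 : 1 - 8 / t ≤ 1 := by linarith [show 0 < 8 / t by positivity]
  rw [volume_real_Icc_prod_Icc e1 e2] at hlower
  rw [volume_real_Icc_prod_Icc (by positivity) e3,
    volume_real_Icc_prod_Icc e4 (by positivity)] at hupper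
  have hl : (1 / t - 1 / (2 * t)) * (1 - (1 - 1 / (2 * t))) = 1 / 4 / t ^ 2 := by
    field_simp
    norm_num
  have hu : (2 / t - 0) * (1 - (1 - 4 / t)) + (1 - (1 - 8 / t)) * (4 / t - 0) = 40 / t ^ 2 := by
    field_simp
    norm_num
  have hq : 80 / t ^ 2 = 2 * (40 / t ^ 2) := by ring
  have hpos : 0 < 1 / 4 / t ^ 2 := by positivity
  rw [hl] at hlower
  rw [hu] at hupper
  rw [hq]
  exact ⟨by nlinarith, mul_le_mul hc2 hupper measureReal_nonneg zero_le_two⟩
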